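/- For the standard juggling chain: the vector α on landing states ν ∈ {0,1}^h with exactly f zeros given by α(ν) = Δ(ν)/S(h+1,f+1) is a stationary distribution, i.e., α is a probability vector and for every state ω, Σ_ν α(ν)·p(ν,ω) = α(ω), where p(ν,ω) = 1 if ν_1 = 0 and ω = Θ_0(ν), p(ν,ω) = 1/(f+1) if ν_1 = 1 and ω = Θ_j(ν) for some 1 ≤ j ≤ h with ν_{j+1} = 0 (taking ν_{h+1} = 0), and p(ν,ω) = 0 otherwise. -/

import Mathlib

open Finset
open scoped Classical

/-- Stirling numbers of the second kind. -/
def stirling : ℕ → ℕ → ℕ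
  | 0, 0 => 1
  | 0, _ + 1 => 0
  | _ + 1, 0 => 0
  | n + 1, k + 1 => (k + 1) * stirling n (k + 1) + stirling n k

/-- Bell numbers. -/
def bellNum (n : ℕ) : ℕ := ∑ k ∈ Finset.range (n + 1), stirling n k

/-- A TL-state of length `h`: `ν t = 0` means no ball lands at (1-based) time `t+1`;
otherwise `ν t` is the airtime of the ball landing at time `t+1`, which must be `≥ t+1`,
and no two balls were thrown at the same instant. -/
def IsTL (h : ℕ) (ν : Fin h → Fin (h + 1)) : Prop :=
  (∀ t : Fin h, (ν t : ℕ) = 0 ∨ t.val + 1 ≤ (ν t : ℕ)) ∧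
  ∀ j k : Fin h, j ≠ k → (ν j : ℕ) ≠ 0 → (ν k : ℕ) ≠ 0 →
    (ν j : ℕ) + k.val ≠ (ν k : ℕ) + j.val

/-- Number of empty slots of a TL-state. -/
def tlZeros {h : ℕ} (ν : Fin h → Fin (h + 1)) : ℕ :=
  (Finset.univ.filter (fun t : Fin h => (ν t : ℕ) = 0)).card

/-- Number of zeros of a landing state. -/
def numZeros {h : ℕ} (ν : Fin h → Bool) : ℕ :=
  (Finset.univ.filter (fun t : Fin h => ν t = false)).card

/-- `φ_t(ν)` (with `t : Fin h` representing 1-based time `t+1`). -/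
def phi {h : ℕ} (ν : Fin h → Bool) (t : Fin h) : ℕ :=
  if ν t = true then
    (Finset.univ.filter (fun j : Fin h => t < j ∧ ν j = false)).card
  else 0

/-- The weight `Δ(ν)`. -/
def Delta {h : ℕ} (ν : Fin h → Bool) : ℕ := ∏ t : Fin h, (1 + phi ν t)

/-- 1-based access to a landing state, `false` out of range (convention `ν_t = 0` for `t > h`). -/
def getB {h : ℕ} (ν : Fin h → Bool) (j : ℕ) : Bool :=
  if hj : 1 ≤ j ∧ j ≤ h then ν ⟨j - 1, by omega⟩ else false

/-- Throwing operator on landing states: `theta 0` is the left shift (wait), and for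
`1 ≤ j`, `theta j` shifts left and places a ball at 1-based position `j`. -/
def theta {h : ℕ} (j : ℕ) (ν : Fin h → Bool) : Fin h → Bool :=
  fun t => if t.val + 1 = j then true else getB ν (t.val + 2)

/-- 1-based access to a TL-state given as a ℕ-valued tuple, `0` out of range. -/
def getN {h : ℕ} (ν : Fin h → ℕ) (j : ℕ) : ℕ :=
  if hj : 1 ≤ j ∧ j ≤ h then ν ⟨j - 1, by omega⟩ else 0

/-- Throwing operator on ℕ-valued TL-states. -/
def thetaN {h : ℕ} (j : ℕ) (ν : Fin h → ℕ) : Fin h → ℕ :=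
  fun t => if t.val + 1 = j then j else getN ν (t.val + 2)

/-- Transition probabilities for the standard juggling chain on landing states. -/
noncomputable def pStd (h f : ℕ) (ν ω : Fin h → Bool) : ℝ :=
  if getB ν 1 = false then (if ω = theta 0 ν then 1 else 0)
  else if ∃ j, 1 ≤ j ∧ j ≤ h ∧ getB ν (j + 1) = false ∧ ω = theta j ν then
    1 / ((f : ℝ) + 1)
  else 0

/-- The set of landing states with exactly `f` zeros. -/
noncomputable def States (h f : ℕ) : Finset (Fin h → Bool) :=
  Finset.univ.filter (fun ν => numZeros ν = f)

/-- The set of TL-states with exactly `f` empty slots. -/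
noncomputable def TLStates (h f : ℕ) : Finset (Fin h → Fin (h + 1)) :=
  Finset.univ.filter (fun ν => IsTL h ν ∧ tlZeros ν = f)

/-- Projection from TL-states to landing states. -/
def proj {h : ℕ} (ν : Fin h → Fin (h + 1)) : Fin h → Bool :=
  fun t => decide ((ν t : ℕ) ≠ 0)

/-- Transition probabilities for the TL-state chain. -/
noncomputable def pHat (h f : ℕ) (μ ν : Fin h → Fin (h + 1)) : ℝ :=
  if getN (h := h) (fun s => (μ s : ℕ)) 1 = 0 then
    (if (fun s => (ν s : ℕ)) = thetaN 0 (fun s => (μ s : ℕ)) then 1 else 0)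
  else if ∃ j, 1 ≤ j ∧ j ≤ h ∧ getN (h := h) (fun s => (μ s : ℕ)) (j + 1) = 0 ∧
      (fun s => (ν s : ℕ)) = thetaN j (fun s => (μ s : ℕ)) then
    1 / ((f : ℝ) + 1)
  else 0

theorem numZeros_cons {n : ℕ} (b : Bool) (x : Fin n → Bool) :
    numZeros (Fin.cons b x : Fin (n + 1) → Bool) = (if b then 0 else 1) + numZeros x := by
  cases b <;> simp [numZeros, card_filter, -sum_boole, Fin.sum_univ_succ]

theorem numZeros_snoc {n : ℕ} (x : Fin n → Bool) (b : Bool) :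
    numZeros (Fin.snoc x b : Fin (n + 1) → Bool) = numZeros x + (if b then 0 else 1) := by
  cases b <;> simp [numZeros, card_filter, -sum_boole, Fin.sum_univ_castSucc]

theorem numZeros_update_false {n : ℕ} (y : Fin n → Bool) (j : Fin n) (hj : y j = true) :
    numZeros (Function.update y j false) = numZeros y + 1 := by
  have : univ.filter (fun t => Function.update y j false t = false)
      = insert j (univ.filter fun t => y t = false) := by
    ext t
    by_cases h : t = j <;> simp [Function.update_apply, h]
  rw [numZeros, this, card_insert_of_notMem (by simp [hj]), numZeros]

theorem phi_cons_succ {n : ℕ} (b : Bool) (x : Fin n → Bool) (t : Fin n) :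
    phi (Fin.cons b x : Fin (n + 1) → Bool) t.succ = phi x t := by
  simp [phi, card_filter, -sum_boole, Fin.sum_univ_succ]

theorem phi_cons_zero {n : ℕ} (b : Bool) (x : Fin n → Bool) :
    phi (Fin.cons b x : Fin (n + 1) → Bool) 0 = if b then numZeros x else 0 := by
  simp [phi, numZeros, card_filter, -sum_boole, Fin.sum_univ_succ]

theorem Delta_cons {n : ℕ} (b : Bool) (x : Fin n → Bool) :
    Delta (Fin.cons b x : Fin (n + 1) → Bool) = (if b then 1 + numZeros x else 1) * Delta x := by
  cases b <;> simp [Delta, Fin.prod_univ_succ, phi_cons_succ, phi_cons_zero]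

theorem Delta_snoc_true {n : ℕ} (x : Fin n → Bool) :
    Delta (Fin.snoc x true : Fin (n + 1) → Bool) = Delta x := by
  simp [Delta, phi, card_filter, -sum_boole, Fin.prod_univ_castSucc, Fin.sum_univ_castSucc,
    (Fin.castSucc_lt_last _).not_gt]

/-- Appending an empty slot decomposes the weight over the ways of emptying at most one slot. -/
theorem Delta_snoc_false {n : ℕ} (y : Fin n → Bool) :
    Delta (Fin.snoc y false : Fin (n + 1) → Bool)
      = Delta y + ∑ j, if y j = true then Delta (Function.update y j false) else 0 := by
  induction n with
  | zero => simp [Delta, phi]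
  | succ n ih =>
    induction y using Fin.consCases with
    | _ b x =>
      rw [← Fin.cons_snoc_eq_snoc_cons, Delta_cons, ih, Delta_cons, Fin.sum_univ_succ]
      have key : ∀ j : Fin n,
          (if (Fin.cons b x : Fin (n + 1) → Bool) j.succ = true then
            Delta (Function.update (Fin.cons b x : Fin (n + 1) → Bool) j.succ false) else 0)
          = (if b then 2 + numZeros x else 1) *
            (if x j = true then Delta (Function.update x j false) else 0) := by
        intro j
        rw [Fin.cons_succ]
        by_cases h1 : x j = true
        · rw [if_pos h1, if_pos h1, ← Fin.cons_update, Delta_cons, numZeros_update_false x j h1]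
          congr 2
          ring
        · rw [if_neg h1, if_neg h1, mul_zero]
      rw [sum_congr rfl fun j _ => key j, ← mul_sum]
      cases b
      · simp
      · simp [Fin.update_cons_zero, Delta_cons, numZeros_snoc]
        ring

theorem sum_boolFun_succ {n : ℕ} {M : Type*} [AddCommMonoid M] (F : (Fin (n + 1) → Bool) → M) :
    ∑ ν, F ν = ∑ x : Fin n → Bool, F (Fin.cons false x) + ∑ x : Fin n → Bool, F (Fin.cons true x) := by
  rw [← (Fin.consEquiv fun _ : Fin (n + 1) => Bool).sum_comp, Fintype.sum_prod_type,
    Fintype.sum_bool, add_comm]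
  rfl

theorem sum_Delta (h f : ℕ) :
    ∑ ν : Fin h → Bool, (if numZeros ν = f then Delta ν else 0) = stirling (h + 1) (f + 1) := by
  induction h generalizing f with
  | zero => rcases f with _ | f <;> simp [numZeros, Delta, stirling]
  | succ h ih =>
    rw [sum_boolFun_succ, stirling, ← ih f, mul_sum, add_comm]
    congr 1
    · refine sum_congr rfl fun x _ => ?_
      simp only [numZeros_cons, Delta_cons, if_true, zero_add, mul_ite, mul_zero]
      refine if_ctx_congr Iff.rfl (fun hx => ?_) fun _ => rfl
      rw [hx, add_comm]
    · rcases f with _ | f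
      · simp [numZeros_cons, stirling]
      · rw [← ih f]
        refine sum_congr rfl fun x _ => ?_
        simp [numZeros_cons, Delta_cons, add_comm 1]

theorem stirling_pos {n k : ℕ} (hk : k ≤ n) : 0 < stirling (n + 1) (k + 1) := by
  induction n generalizing k with
  | zero => obtain rfl : k = 0 := by omega
            simp [stirling]
  | succ n ih =>
    rw [stirling]
    rcases hk.lt_or_eq with h | rfl
    · have := ih (Nat.lt_succ_iff.mp h)
      positivity
    · have := ih le_rfl
      omega

theorem getB_cons_one {n : ℕ} (b : Bool) (x : Fin n → Bool) :
    getB (Fin.cons b x : Fin (n + 1) → Bool) 1 = b := by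
  simp [getB]

theorem getB_cons_add_two {n : ℕ} (b : Bool) (x : Fin n → Bool) (t : Fin (n + 1)) :
    getB (Fin.cons b x : Fin (n + 1) → Bool) (t.val + 2)
      = (Fin.snoc x false : Fin (n + 1) → Bool) t := by
  induction t using Fin.lastCases with
  | last => simp [getB]
  | cast t =>
    have : (⟨t.val + 1, by omega⟩ : Fin (n + 1)) = t.succ := rfl
    simp [getB, this]

theorem theta_zero_cons {n : ℕ} (b : Bool) (x : Fin n → Bool) :
    theta 0 (Fin.cons b x : Fin (n + 1) → Bool) = Fin.snoc x false := by
  ext t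
  simp [theta, getB_cons_add_two]

theorem theta_succ_cons {n : ℕ} (b : Bool) (x : Fin n → Bool) (j : Fin (n + 1)) :
    theta (j.val + 1) (Fin.cons b x : Fin (n + 1) → Bool)
      = Function.update (Fin.snoc x false : Fin (n + 1) → Bool) j true := by
  ext t
  simp [theta, getB_cons_add_two, Function.update_apply, Fin.ext_iff]

theorem pStd_cons_false {n : ℕ} (f : ℕ) (x y : Fin n → Bool) (c : Bool) :
    pStd (n + 1) f (Fin.cons false x) (Fin.snoc y c) = if x = y ∧ c = false then 1 else 0 := by
  rw [pStd, getB_cons_one, if_pos rfl, theta_zero_cons]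
  refine if_congr ?_ rfl rfl
  rw [Fin.snoc_inj, eq_comm (a := y), eq_comm (a := c), eq_comm (a := false)]

theorem exists_theta_iff {n : ℕ} (x : Fin n → Bool) (ω : Fin (n + 1) → Bool) :
    (∃ j, 1 ≤ j ∧ j ≤ n + 1 ∧ getB (Fin.cons true x : Fin (n + 1) → Bool) (j + 1) = false ∧
        ω = theta j (Fin.cons true x : Fin (n + 1) → Bool)) ↔
      ∃ j : Fin (n + 1), ω j = true ∧ Fin.snoc x false = Function.update ω j false := by
  constructor
  · rintro ⟨j, h1, h2, h3, h4⟩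
    obtain ⟨j, rfl⟩ : ∃ k : Fin (n + 1), j = k.val + 1 := ⟨⟨j - 1, by omega⟩, by simp; omega⟩
    rw [add_assoc, getB_cons_add_two] at h3
    rw [theta_succ_cons] at h4
    subst h4
    refine ⟨j, by simp, ?_⟩
    rw [Function.update_idem, eq_comm, Function.update_eq_self_iff, h3]
  · rintro ⟨j, h1, h2⟩
    refine ⟨j.val + 1, by omega, by omega, ?_, ?_⟩
    · rw [add_assoc, getB_cons_add_two, h2, Function.update_self]
    · rw [theta_succ_cons, h2, Function.update_idem, ← h1, Function.update_eq_self]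

theorem pStd_cons_true_snoc_true {n : ℕ} (f : ℕ) (x y : Fin n → Bool) :
    pStd (n + 1) f (Fin.cons true x) (Fin.snoc y true)
      = if x = y then 1 / ((f : ℝ) + 1) else 0 := by
  rw [pStd, getB_cons_one, if_neg (by simp)]
  refine if_congr ?_ rfl rfl
  rw [exists_theta_iff, Fin.exists_fin_succ']
  simp [← Fin.snoc_update, Fin.snoc_inj, Fin.update_snoc_last]

theorem pStd_cons_true_snoc_false {n : ℕ} (f : ℕ) (x y : Fin n → Bool) :
    pStd (n + 1) f (Fin.cons true x) (Fin.snoc y false)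
      = if ∃ j, y j = true ∧ x = Function.update y j false then 1 / ((f : ℝ) + 1) else 0 := by
  rw [pStd, getB_cons_one, if_neg (by simp)]
  refine if_congr ?_ rfl rfl
  rw [exists_theta_iff, Fin.exists_fin_succ']
  simp [← Fin.snoc_update, Fin.snoc_inj]

theorem sum_Delta_emptied {n : ℕ} (y : Fin n → Bool) :
    ∑ x, (if ∃ j, y j = true ∧ x = Function.update y j false then Delta x else 0)
      = ∑ j, if y j = true then Delta (Function.update y j false) else 0 := by
  rw [← sum_filter, ← sum_filter, ← sum_image (f := Delta)
    (g := fun j => Function.update y j false)]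
  · congr 1
    ext x
    simp only [mem_filter, mem_image, mem_univ, true_and, eq_comm (a := x)]
  · intro j hj k hk hjk
    by_contra hne
    have hy := congrFun hjk j
    replace hj := (mem_filter.mp hj).2
    simp [hne, hj] at hy

theorem sum_Delta_mul_pStd (h f : ℕ) (ω : Fin h → Bool) (hω : numZeros ω = f) :
    ∑ ν : Fin h → Bool, (if numZeros ν = f then (Delta ν : ℝ) * pStd h f ν ω else 0)
      = Delta ω := by
  subst hω
  rcases h with _ | n
  · have hp : ∀ ν, pStd 0 (numZeros ω) ν ω = 1 := fun ν => by
      simp [pStd, getB, Subsingleton.elim ω (theta 0 ν)]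
    rw [Fintype.sum_subsingleton _ ω, if_pos rfl, hp, mul_one]
  · have hf : ((numZeros ω : ℝ) + 1) ≠ 0 := by positivity
    rw [sum_boolFun_succ]
    induction ω using Fin.snocCases with
    | _ y c =>
      cases c
      · rw [Delta_snoc_false, ← sum_Delta_emptied]
        push_cast
        congr 1
        · rw [sum_eq_single y]
          · simp [numZeros_cons, numZeros_snoc, Delta_cons, pStd_cons_false, add_comm]
          · intro x _ hx
            simp [pStd_cons_false, hx]
          · simp
        · refine sum_congr rfl fun x _ => ?_
          rw [pStd_cons_true_snoc_false]
          by_cases hx : ∃ j, y j = true ∧ x = Function.update y j false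
          · have hz : numZeros x = numZeros y + 1 := by
              obtain ⟨j, hj, rfl⟩ := hx
              exact numZeros_update_false y j hj
            rw [if_pos hx, if_pos hx, if_pos (by simp [numZeros_cons, numZeros_snoc, hz])]
            simp only [numZeros_snoc, Delta_cons, hz] at hf ⊢
            push_cast at hf ⊢
            simp at hf ⊢
            field_simp
            ring
          · simp [hx]
      · rw [Delta_snoc_true, sum_eq_zero, zero_add, sum_eq_single y]
        · simp only [numZeros_snoc, numZeros_cons, Delta_cons, pStd_cons_true_snoc_true] at hf ⊢
          simp at hf ⊢
          field_simp
          ring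
        · intro x _ hx
          simp [pStd_cons_true_snoc_true, hx]
        · simp
        · simp [pStd_cons_false]

/-- `α(ν) = Δ(ν)/S(h+1,f+1)` is a stationary probability distribution for the standard
juggling chain on landing states with `f` zeros. -/
theorem stmt10 (h f : ℕ) (hf : f ≤ h) :
    (∑ ν ∈ States h f, (Delta ν : ℝ) / (stirling (h + 1) (f + 1) : ℝ)) = 1 ∧
    ∀ ω ∈ States h f,
      (∑ ν ∈ States h f,
          (Delta ν : ℝ) / (stirling (h + 1) (f + 1) : ℝ) * pStd h f ν ω)
        = (Delta ω : ℝ) / (stirling (h + 1) (f + 1) : ℝ) := by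
  have hS : (stirling (h + 1) (f + 1) : ℝ) ≠ 0 := by
    exact_mod_cast (stirling_pos hf).ne'
  refine ⟨?_, fun ω hω => ?_⟩
  · rw [← sum_div, div_eq_one_iff_eq hS, States, sum_filter, ← sum_Delta]
    push_cast
    rfl
  · rw [← sum_Delta_mul_pStd h f ω (by simpa [States] using hω), States, sum_filter, sum_div]
    refine sum_congr rfl fun ν _ => ?_
    split_ifs <;> ring
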